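/- arXiv:2101.04967 — 2 statements merged into one kernel-verified Lean document; each statement's English description precedes it below -/
import Mathlib

section
/- A topological dynamical system (X,T) is uniform if and only if it is continuously pointwise ergodic. In particular, if every point x ∈ X is generic for an ergodic measure Φ(x) and Φ : X → ℳ_T^e(X) is continuous, then for every continuous f : X → ℝ the Cesàro means (1/n)∑_{i=0}^{n-1} f(T^i x) converge to ∫ f dΦ(x) uniformly in x ∈ X. -/
open MeasureTheory Filter Topology Metric

section TopDefs

variable {X : Type*} [MetricSpace X]

/-- The Cesàro (Birkhoff) averages `(1/n) ∑_{i<n} f(Tⁱ x)`. -/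
noncomputable def cesaro (T : X → X) (f : X → ℝ) (n : ℕ) (x : X) : ℝ :=
  (n : ℝ)⁻¹ * ∑ i ∈ Finset.range n, f (T^[i] x)

/-- `P` is a partition of `X` (into nonempty sets, every point in exactly one atom). -/
def IsPartition (P : Set (Set X)) : Prop :=
  (∀ A ∈ P, A.Nonempty) ∧ ∀ x : X, ∃! A : Set X, A ∈ P ∧ x ∈ A

/-- A partition is upper semicontinuous if whenever a sequence of atoms converges in the
Hausdorff metric to a (nonempty compact) set `S`, then `S` is contained in some atom. -/
def PartitionUSC (P : Set (Set X)) : Prop :=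
  ∀ A : ℕ → Set X, (∀ n, A n ∈ P) → ∀ S : Set X, S.Nonempty → IsCompact S →
    Tendsto (fun n => hausdorffDist (A n) S) atTop (𝓝 0) → ∃ B ∈ P, S ⊆ B

/-- A partition is lower semicontinuous if whenever a sequence of atoms converges in the
Hausdorff metric to a (nonempty compact) set `S`, then `S` contains some atom. -/
def PartitionLSC (P : Set (Set X)) : Prop :=
  ∀ A : ℕ → Set X, (∀ n, A n ∈ P) → ∀ S : Set X, S.Nonempty → IsCompact S →
    Tendsto (fun n => hausdorffDist (A n) S) atTop (𝓝 0) → ∃ B ∈ P, B ⊆ S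

/-- Upper semicontinuity of a (compact-)set-valued function: if `yₙ → y₀` and
`f(yₙ) → S` in the Hausdorff metric, then `S ⊆ f(y₀)`. -/
def SetValuedUSC {Y : Type*} [MetricSpace Y] (f : Y → Set X) : Prop :=
  ∀ (y : ℕ → Y) (y₀ : Y), Tendsto y atTop (𝓝 y₀) →
    ∀ S : Set X, S.Nonempty → IsCompact S →
      Tendsto (fun n => hausdorffDist (f (y n)) S) atTop (𝓝 0) → S ⊆ f y₀

/-- Lower semicontinuity of a (compact-)set-valued function: if `yₙ → y₀` and
`f(yₙ) → S` in the Hausdorff metric, then `f(y₀) ⊆ S`. -/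
def SetValuedLSC {Y : Type*} [MetricSpace Y] (f : Y → Set X) : Prop :=
  ∀ (y : ℕ → Y) (y₀ : Y), Tendsto y atTop (𝓝 y₀) →
    ∀ S : Set X, S.Nonempty → IsCompact S →
      Tendsto (fun n => hausdorffDist (f (y n)) S) atTop (𝓝 0) → f y₀ ⊆ S

/-- A set is invariant for the homeomorphism `T` if `T(K) = K`. -/
def IsInvariantSet (T : X ≃ₜ X) (K : Set X) : Prop := T '' K = K

/-- A minimal set: nonempty, closed, invariant, with no proper nonempty closed invariant
subset. -/
def IsMinimalSet (T : X ≃ₜ X) (K : Set X) : Prop :=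
  K.Nonempty ∧ IsClosed K ∧ IsInvariantSet T K ∧
    ∀ K' : Set X, K' ⊆ K → K'.Nonempty → IsClosed K' → IsInvariantSet T K' → K' = K

/-- A system is semi-simple if `X` is a union of minimal sets. -/
def SemiSimple (T : X ≃ₜ X) : Prop :=
  ∀ x : X, ∃ K : Set X, IsMinimalSet T K ∧ x ∈ K

/-- A system is uniform if the Cesàro means of every continuous function converge
uniformly on `X`. -/
def UniformSystem (T : X ≃ₜ X) : Prop :=
  ∀ f : C(X, ℝ), ∃ g : X → ℝ,
    TendstoUniformly (fun n x => cesaro (⇑T) (⇑f) n x) g atTop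

/-- Uniformity of the subsystem carried by the set `M`: the Cesàro means of every
continuous function converge uniformly on `M`. -/
def UniformOn (T : X ≃ₜ X) (M : Set X) : Prop :=
  ∀ f : C(X, ℝ), ∃ g : X → ℝ,
    TendstoUniformlyOn (fun n x => cesaro (⇑T) (⇑f) n x) g atTop M

/-- Strictly uniform = uniform + semi-simple. -/
def StrictlyUniform (T : X ≃ₜ X) : Prop := UniformSystem T ∧ SemiSimple T

end TopDefs

section MeasDefs

variable {X : Type*} [MetricSpace X] [CompactSpace X]
  [MeasurableSpace X] [BorelSpace X]

/-- A `T`-invariant Borel probability measure. -/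
def IsInvariantMeasure (T : X ≃ₜ X) (μ : ProbabilityMeasure X) : Prop :=
  μ.toMeasure.map ⇑T = μ.toMeasure

/-- An ergodic `T`-invariant Borel probability measure. -/
def IsErgodicMeasure (T : X ≃ₜ X) (μ : ProbabilityMeasure X) : Prop :=
  Ergodic (⇑T) μ.toMeasure

/-- `x` is generic for `μ`: the Cesàro means of every continuous function at `x`
converge to the integral of the function against `μ`. -/
def IsGenericFor (T : X ≃ₜ X) (x : X) (μ : ProbabilityMeasure X) : Prop :=
  ∀ f : C(X, ℝ),
    Tendsto (fun n => cesaro (⇑T) (⇑f) n x) atTop (𝓝 (∫ y, f y ∂μ.toMeasure))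

/-- Pointwise ergodic: every point is generic for some ergodic measure. -/
def PointwiseErgodic (T : X ≃ₜ X) : Prop :=
  ∀ x : X, ∃ μ : ProbabilityMeasure X, IsErgodicMeasure T μ ∧ IsGenericFor T x μ

/-- The set of points generic for `μ` (a fiber of the map `Φ`). -/
def genericFiber (T : X ≃ₜ X) (μ : ProbabilityMeasure X) : Set X :=
  {x : X | IsGenericFor T x μ}

/-- The generic-point partition `𝒫`: the (nonempty) fibers of the map `Φ` sending each
point to the ergodic measure it generates. -/
def genericPartition (T : X ≃ₜ X) : Set (Set X) :=
  {A : Set X | ∃ μ : ProbabilityMeasure X, IsErgodicMeasure T μ ∧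
    (genericFiber T μ).Nonempty ∧ A = genericFiber T μ}

/-- Continuously pointwise ergodic: every point is generic for an ergodic measure and the
map `Φ` sending each point to that measure is continuous (weak-star topology). -/
def ContinuouslyPointwiseErgodic (T : X ≃ₜ X) : Prop :=
  ∃ Φ : X → ProbabilityMeasure X, Continuous Φ ∧
    ∀ x : X, IsErgodicMeasure T (Φ x) ∧ IsGenericFor T x (Φ x)

/-- Continuously strictly pointwise ergodic = continuously pointwise ergodic +
semi-simple. -/
def ContinuouslyStrictlyPointwiseErgodic (T : X ≃ₜ X) : Prop :=
  ContinuouslyPointwiseErgodic T ∧ SemiSimple T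

/-- The set `K` carries exactly one `T`-invariant Borel probability measure. -/
def UniquelyErgodicOn (T : X ≃ₜ X) (K : Set X) : Prop :=
  ∃! μ : ProbabilityMeasure X, IsInvariantMeasure T μ ∧ μ.toMeasure K = 1

/-- Partitionable: `X` is a disjoint union of closed invariant uniquely ergodic sets. -/
def Partitionable (T : X ≃ₜ X) : Prop :=
  ∃ P : Set (Set X), IsPartition P ∧
    ∀ K ∈ P, IsClosed K ∧ IsInvariantSet T K ∧ UniquelyErgodicOn T K

/-- Strictly partitionable: `X` is a union of strictly ergodic (minimal and uniquely
ergodic) subsystems. -/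
def StrictlyPartitionable (T : X ≃ₜ X) : Prop :=
  ∀ x : X, ∃ K : Set X, x ∈ K ∧ IsMinimalSet T K ∧ UniquelyErgodicOn T K

/-- The topological support of a measure: points all of whose open neighborhoods have
positive measure (equivalently, the smallest closed set of full measure). -/
def msupp (μ : ProbabilityMeasure X) : Set X :=
  {x : X | ∀ U : Set X, IsOpen U → x ∈ U → 0 < μ.toMeasure U}

/-- The set `ℳ_T^e(X)` of ergodic invariant probability measures. -/
def ErgodicSet (T : X ≃ₜ X) : Set (ProbabilityMeasure X) :=
  {μ : ProbabilityMeasure X | IsErgodicMeasure T μ}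

/-- Continuity of the set-valued map `supp : ℳ_T^e(X) → 2^X` (sequentially, via the
Hausdorff metric; `ℳ_T^e(X)` carries the weak-star topology, which is metrizable). -/
def SuppContinuousOnErgodic (T : X ≃ₜ X) : Prop :=
  ∀ μ ∈ ErgodicSet T, ∀ ν : ℕ → ProbabilityMeasure X,
    (∀ n, ν n ∈ ErgodicSet T) → Tendsto ν atTop (𝓝 μ) →
    Tendsto (fun n => hausdorffDist (msupp (ν n)) (msupp μ)) atTop (𝓝 0)

end MeasDefs
section Aux

variable {X : Type*} [MetricSpace X] [CompactSpace X] [MeasurableSpace X] [BorelSpace X]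

lemma aux_int (μ : ProbabilityMeasure X) {f : X → ℝ} (hf : Continuous f) :
    Integrable f μ.toMeasure :=
  (BoundedContinuousFunction.mkOfCompact ⟨f, hf⟩).integrable μ.toMeasure

lemma aux_empirical (T : X ≃ₜ X) (n : ℕ) (x : X) :
    ∃ E : ProbabilityMeasure X, n ≠ 0 → ∀ f : C(X, ℝ), ∫ y, f y ∂E.toMeasure = cesaro T f n x := by
  by_cases hn : n = 0
  · exact ⟨⟨Measure.dirac x, inferInstance⟩, fun h => absurd hn h⟩
  · refine ⟨⟨(n : ENNReal)⁻¹ • ∑ i ∈ Finset.range n, Measure.dirac (T^[i] x), ⟨?_⟩⟩, fun _ f => ?_⟩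
    · simp only [Measure.smul_apply, Measure.finsetSum_apply, measure_univ, smul_eq_mul]
      simp only [Finset.sum_const, Finset.card_range, nsmul_eq_mul, mul_one]
      exact ENNReal.inv_mul_cancel (by simpa using hn) (by simp)
    · simp only [ProbabilityMeasure.coe_mk, cesaro]
      rw [integral_smul_measure, integral_finsetSum_measure]
      · simp
      · intro i _
        exact (BoundedContinuousFunction.mkOfCompact f).integrable _

lemma aux_bound (f : C(X, ℝ)) (x : X) : |f x| ≤ ‖f‖ := f.norm_coe_le_norm x

lemma aux_shift (T : X → X) (f : X → ℝ) (n : ℕ) (x : X) :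
    cesaro T f n (T x) - cesaro T f n x = (n : ℝ)⁻¹ * (f (T^[n] x) - f x) := by
  simp only [cesaro, ← mul_sub, ← Finset.sum_sub_distrib]
  congr 1
  have := Finset.sum_range_sub (fun i => f (T^[i] x)) n
  simpa [Function.iterate_succ_apply] using this

lemma aux_shift_tendsto (T : X ≃ₜ X) (f : C(X, ℝ)) (x : ℕ → X) :
    Tendsto (fun n => cesaro T f n (T (x n)) - cesaro T f n (x n)) atTop (𝓝 0) := by
  have h : Tendsto (fun n : ℕ => (n : ℝ)⁻¹ * (2 * ‖f‖)) atTop (𝓝 0) := by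
    simpa using (tendsto_inv_atTop_nhds_zero_nat (𝕜 := ℝ)).mul_const (2 * ‖f‖)
  refine squeeze_zero_norm (fun n => ?_) h
  rw [aux_shift, norm_mul, Real.norm_eq_abs, Real.norm_eq_abs, abs_of_nonneg (by positivity)]
  gcongr
  have h1 := abs_le.1 (aux_bound f (T^[n] (x n)))
  have h2 := abs_le.1 (aux_bound f (x n))
  rw [abs_le]; constructor <;> linarith

lemma aux_cesaro_comp (T : X → X) (f : X → ℝ) (n : ℕ) (x : X) :
    cesaro T (fun y => f (T y)) n x = cesaro T f n (T x) := by
  simp only [cesaro, ← Function.iterate_succ_apply, Function.iterate_succ_apply']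

lemma aux_inv (T : X ≃ₜ X) (μ : ProbabilityMeasure X)
    (h : ∀ f : C(X, ℝ), ∫ y, f (T y) ∂μ.toMeasure = ∫ y, f y ∂μ.toMeasure) :
    MeasurePreserving T μ.toMeasure μ.toMeasure := by
  refine ⟨T.continuous.measurable, ?_⟩
  haveI : IsProbabilityMeasure (μ.toMeasure.map T) :=
    Measure.isProbabilityMeasure_map T.continuous.measurable.aemeasurable
  apply ext_of_forall_integral_eq_of_IsFiniteMeasure
  intro f
  rw [integral_map T.continuous.measurable.aemeasurable
    f.continuous.aestronglyMeasurable]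
  exact h f.toContinuousMap

lemma aux_limit (T : X ≃ₜ X) (x : ℕ → X) (U : Ultrafilter ℕ) (hU : (U : Filter ℕ) ≤ atTop) :
    ∃ μ : ProbabilityMeasure X, MeasurePreserving T μ.toMeasure μ.toMeasure ∧
      ∀ f : C(X, ℝ), Tendsto (fun n => cesaro T f n (x n)) U (𝓝 (∫ y, f y ∂μ.toMeasure)) := by
  choose E hE using fun n => aux_empirical T n (x n)
  obtain ⟨μ, -, hμ⟩ := isCompact_univ.ultrafilter_le_nhds (U.map E) (by simp)
  have hconv : ∀ f : C(X, ℝ),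
      Tendsto (fun n => cesaro T f n (x n)) U (𝓝 (∫ y, f y ∂μ.toMeasure)) := by
    intro f
    have h1 : Tendsto E U (𝓝 μ) := hμ
    have h2 := ProbabilityMeasure.tendsto_iff_forall_integral_tendsto.1 h1
      (BoundedContinuousFunction.mkOfCompact f)
    refine h2.congr' ?_
    filter_upwards [hU (eventually_ne_atTop 0)] with n hn
    exact hE n hn f
  refine ⟨μ, aux_inv T μ fun f => ?_, hconv⟩
  have h1 := hconv (f.comp ⟨T, T.continuous⟩)
  have h2 := (hconv f).add ((aux_shift_tendsto T f x).mono_left hU)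
  rw [add_zero] at h2
  refine tendsto_nhds_unique h1 (h2.congr fun n => ?_)
  have := aux_cesaro_comp T f n (x n)
  simp only [add_sub_cancel]
  exact this.symm

lemma aux_cesaro_cont (T : X ≃ₜ X) {f : X → ℝ} (hf : Continuous f) (n : ℕ) :
    Continuous (cesaro T f n) := by
  unfold cesaro
  exact continuous_const.mul (continuous_finsetSum _ fun i _ =>
    hf.comp (T.continuous.iterate i))

lemma aux_cesaro_bound (T : X ≃ₜ X) (f : C(X, ℝ)) (n : ℕ) (x : X) :
    ‖cesaro T f n x‖ ≤ ‖f‖ := by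
  unfold cesaro
  rcases eq_or_ne n 0 with rfl | hn
  · simp
  rw [norm_mul, norm_inv, Real.norm_natCast, inv_mul_le_iff₀ (by positivity)]
  refine (norm_sum_le_of_le _ (fun i _ => f.norm_coe_le_norm _)).trans ?_
  simp

lemma aux_setint_cesaro (T : X ≃ₜ X) (μ : Measure X) [IsProbabilityMeasure μ]
    (hμ : MeasurePreserving T μ μ) (f : C(X, ℝ)) {A : Set X} (hA : MeasurableSet A)
    (hTA : T ⁻¹' A = A) (n : ℕ) (hn : n ≠ 0) :
    ∫ y in A, cesaro T f n y ∂μ = ∫ y in A, f y ∂μ := by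
  have hi : ∀ i : ℕ, ∫ y in A, f (T^[i] y) ∂μ = ∫ y in A, f y ∂μ := by
    intro i
    have hp : MeasurePreserving T (μ.restrict A) (μ.restrict A) := by
      have := hμ.restrict_preimage hA
      rwa [hTA] at this
    have hm := hp.iterate i
    have h3 := integral_map (μ := μ.restrict A) hm.measurable.aemeasurable
      (f := f) (f.continuous.aestronglyMeasurable)
    rw [hm.map_eq] at h3
    exact h3.symm
  unfold cesaro
  rw [integral_const_mul, integral_finsetSum]
  · simp only [hi, Finset.sum_const, Finset.card_range, nsmul_eq_mul]
    field_simp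
  · intro i _
    exact (BoundedContinuousFunction.mkOfCompact
      ⟨fun y => f (T^[i] y), f.continuous.comp (T.continuous.iterate i)⟩).integrable _

lemma aux_setint_lim (T : X ≃ₜ X) (μ : Measure X) [IsProbabilityMeasure μ]
    (hμ : MeasurePreserving T μ μ) (f : C(X, ℝ)) {A : Set X} (hA : MeasurableSet A)
    (hTA : T ⁻¹' A = A) (c : ℝ)
    (hc : ∀ᵐ y ∂μ, Tendsto (fun n => cesaro T f n y) atTop (𝓝 c)) :
    ∫ y in A, f y ∂μ = μ.real A * c := by
  have h1 : Tendsto (fun n => ∫ y in A, cesaro T f n y ∂μ) atTop (𝓝 (∫ y in A, c ∂μ)) := by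
    refine tendsto_integral_of_dominated_convergence (fun _ => ‖f‖)
      (fun n => (aux_cesaro_cont T f.continuous n).aestronglyMeasurable)
      (integrable_const _) (fun n => ae_of_all _ (aux_cesaro_bound T f n))
      (ae_restrict_of_ae hc)
  have h2 : Tendsto (fun n => ∫ y in A, cesaro T f n y ∂μ) atTop (𝓝 (∫ y in A, f y ∂μ)) := by
    refine tendsto_const_nhds.congr' ?_
    filter_upwards [eventually_ne_atTop 0] with n hn
    exact (aux_setint_cesaro T μ hμ f hA hTA n hn).symm
  simpa using tendsto_nhds_unique h2 h1

lemma aux_ergodic (T : X ≃ₜ X) (μ : ProbabilityMeasure X)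
    (hμ : MeasurePreserving T μ.toMeasure μ.toMeasure)
    (h : ∀ f : C(X, ℝ), ∀ᵐ y ∂μ.toMeasure,
      Tendsto (fun n => cesaro T f n y) atTop (𝓝 (∫ z, f z ∂μ.toMeasure))) :
    Ergodic T μ.toMeasure := by
  refine ⟨hμ, ⟨fun A hA hTA => ?_⟩⟩
  have key : μ.toMeasure.restrict A = (μ.toMeasure A) • μ.toMeasure := by
    haveI : IsFiniteMeasure ((μ.toMeasure A) • μ.toMeasure) :=
      Measure.smul_finite _ (measure_ne_top _ _)
    apply ext_of_forall_integral_eq_of_IsFiniteMeasure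
    intro f
    rw [integral_smul_measure]
    exact aux_setint_lim T μ.toMeasure hμ f.toContinuousMap hA hTA _ (h f.toContinuousMap)
  have h2 : μ.toMeasure A = μ.toMeasure A * μ.toMeasure A := by
    have := congrArg (fun ν : Measure X => ν A) key
    simpa using this
  rw [eventuallyConst_set']
  by_cases h0 : μ.toMeasure A = 0
  · left; exact ae_eq_empty.2 h0
  · right
    have h3 : μ.toMeasure A = 1 := by
      have h4 : μ.toMeasure A * μ.toMeasure A = μ.toMeasure A * 1 := by rw [mul_one, ← h2]
      exact (ENNReal.mul_right_inj h0 (measure_ne_top _ _)).1 h4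
    rw [ae_eq_univ, prob_compl_eq_zero_iff hA]
    exact h3

lemma aux_forward (T : X ≃ₜ X) (hT : UniformSystem T) : ContinuouslyPointwiseErgodic T := by
  choose g hg using hT
  have hgt : ∀ (f : C(X, ℝ)) x, Tendsto (fun n => cesaro T f n x) atTop (𝓝 (g f x)) :=
    fun f x => (hg f).tendsto_at x
  have hgc : ∀ f, Continuous (g f) := fun f =>
    (hg f).continuous (Eventually.frequently (Eventually.of_forall fun n => aux_cesaro_cont T f.continuous n))
  have hgT : ∀ f x, g f (T x) = g f x := by
    intro f x
    have h1 := (hgt f x).add (aux_shift_tendsto T f (fun _ => x))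
    simp only [add_sub_cancel, add_zero] at h1
    exact tendsto_nhds_unique (hgt f (T x)) h1
  have hgTi : ∀ f x (i : ℕ), g f (T^[i] x) = g f x := by
    intro f x i
    induction i with
    | zero => rfl
    | succ k ih => rw [Function.iterate_succ_apply', hgT, ih]
  choose Φ hΦ hΦl using fun x : X => aux_limit T (fun _ => x) (Ultrafilter.of atTop)
    (Ultrafilter.of_le _)
  have hint : ∀ x f, ∫ y, f y ∂(Φ x).toMeasure = g f x := fun x f =>
    tendsto_nhds_unique (hΦl x f) ((hgt f x).mono_left (Ultrafilter.of_le _))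
  refine ⟨Φ, ?_, fun x => ⟨aux_ergodic T (Φ x) (hΦ x) fun f => ?_, fun f => ?_⟩⟩
  · rw [continuous_iff_continuousAt]
    intro x
    refine ProbabilityMeasure.tendsto_iff_forall_integral_tendsto.2 fun f => ?_
    have := (hgc f.toContinuousMap).tendsto x
    rw [← hint, ← (funext fun z => hint z f.toContinuousMap : (fun z => ∫ y, f.toContinuousMap y ∂(Φ z).toMeasure) = g f.toContinuousMap)] at this
    exact this
  · let k : C(X, ℝ) := ⟨fun y => |g f y - g f x|, ((hgc f).sub continuous_const).abs⟩
    have hk : ∫ y, k y ∂(Φ x).toMeasure = 0 := by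
      rw [hint]
      refine tendsto_nhds_unique (hgt k x) (tendsto_const_nhds.congr fun n => ?_)
      simp [cesaro, k, hgTi]
    have h0 := (integral_eq_zero_iff_of_nonneg (fun y => abs_nonneg _)
      (aux_int (Φ x) k.continuous)).1 hk
    filter_upwards [h0] with y hy
    have : g f y = g f x := by
      have : |g f y - g f x| = 0 := hy
      exact sub_eq_zero.1 (abs_eq_zero.1 this)
    rw [hint, ← this]
    exact hgt f y
  · rw [hint]; exact hgt f x

lemma aux_backward (T : X ≃ₜ X) (Φ : X → ProbabilityMeasure X) (hΦ : Continuous Φ)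
    (hg : ∀ x : X, IsErgodicMeasure T (Φ x) ∧ IsGenericFor T x (Φ x)) (f : C(X, ℝ)) :
    TendstoUniformly (fun n x => cesaro T f n x) (fun x => ∫ y, f y ∂(Φ x).toMeasure) atTop := by
  have hFc : Continuous fun x => ∫ y, f y ∂(Φ x).toMeasure := by
    rw [continuous_iff_continuousAt]
    intro x
    exact ProbabilityMeasure.tendsto_iff_forall_integral_tendsto.1 (hΦ.tendsto x)
      (BoundedContinuousFunction.mkOfCompact f)
  set F : X → ℝ := fun x => ∫ y, f y ∂(Φ x).toMeasure with hF
  have hgt : ∀ x, Tendsto (fun n => cesaro T f n x) atTop (𝓝 (F x)) := fun x => (hg x).2 f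
  have hFT : ∀ x, F (T x) = F x := by
    intro x
    have h1 := (hgt x).add (aux_shift_tendsto T f (fun _ => x))
    simp only [add_sub_cancel, add_zero] at h1
    exact tendsto_nhds_unique (hgt (T x)) h1
  have hFTi : ∀ x (i : ℕ), F (T^[i] x) = F x := by
    intro x i
    induction i with
    | zero => rfl
    | succ k ih => rw [Function.iterate_succ_apply', hFT, ih]
  let h : C(X, ℝ) := ⟨fun x => f x - F x, f.continuous.sub hFc⟩
  have hh : ∀ n x, n ≠ 0 → cesaro T h n x = cesaro T f n x - F x := by
    intro n x hn
    simp only [cesaro, h, ContinuousMap.coe_mk, hFTi, Finset.sum_sub_distrib, Finset.sum_const,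
      Finset.card_range, nsmul_eq_mul]
    field_simp
  rw [Metric.tendstoUniformly_iff]
  intro ε hε
  by_contra hcon
  rw [not_eventually] at hcon
  have hcon2 := hcon.and_eventually (eventually_ne_atTop 0)
  haveI hne : (atTop ⊓ 𝓟 {n : ℕ | (¬ ∀ x, dist (F x) (cesaro T f n x) < ε) ∧ n ≠ 0}).NeBot :=
    frequently_mem_iff_neBot.1 hcon2
  set U := Ultrafilter.of (atTop ⊓ 𝓟 {n : ℕ | (¬ ∀ x, dist (F x) (cesaro T f n x) < ε) ∧ n ≠ 0})
  have hU := Ultrafilter.of_le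
    (atTop ⊓ 𝓟 {n : ℕ | (¬ ∀ x, dist (F x) (cesaro T f n x) < ε) ∧ n ≠ 0})
  have hX : Nonempty X := by
    obtain ⟨n, hn⟩ := hcon.exists
    push Not at hn
    exact ⟨hn.choose⟩
  have hsel : ∀ n : ℕ, ∃ x : X, ((¬ ∀ x, dist (F x) (cesaro T f n x) < ε) ∧ n ≠ 0) →
      ε ≤ |cesaro T h n x| := by
    intro n
    by_cases hn : (¬ ∀ x, dist (F x) (cesaro T f n x) < ε) ∧ n ≠ 0
    · have hn2 := hn.1
      push Not at hn2
      obtain ⟨x, hx⟩ := hn2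
      refine ⟨x, fun _ => ?_⟩
      rw [hh n x hn.2, ← Real.dist_eq, dist_comm]
      exact hx
    · exact ⟨hX.some, fun h' => absurd h' hn⟩
  choose x hx using hsel
  obtain ⟨μ, hμ, hμl⟩ := aux_limit T x U (hU.trans inf_le_left)
  have hzero : ∫ y, h y ∂μ.toMeasure = 0 := by
    have := aux_setint_lim T μ.toMeasure hμ h MeasurableSet.univ rfl 0 (ae_of_all _ fun y => by
      have h1 := (hgt y).sub_const (F y)
      rw [sub_self] at h1
      refine h1.congr' ?_
      filter_upwards [eventually_ne_atTop 0] with n hn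
      exact (hh n y hn).symm)
    simpa using this
  have hl := (hμl h).abs
  rw [hzero, abs_zero] at hl
  have : ε ≤ 0 := by
    refine ge_of_tendsto hl ?_
    filter_upwards [hU (mem_inf_of_right (mem_principal_self _))] with n hn
    exact hx n hn
  linarith

end Aux

/-- `(X,T)` is uniform iff it is continuously pointwise ergodic; in
particular, if every `x` is generic for an ergodic measure `Φ(x)` and `Φ` is continuous,
then the Cesàro means of every continuous `f` converge to `∫ f dΦ(x)` uniformly in `x`. -/
theorem stmt_12 {X : Type*} [MetricSpace X] [CompactSpace X]
    [MeasurableSpace X] [BorelSpace X] (T : X ≃ₜ X) :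
    (UniformSystem T ↔ ContinuouslyPointwiseErgodic T) ∧
    (∀ Φ : X → MeasureTheory.ProbabilityMeasure X, Continuous Φ →
      (∀ x : X, IsErgodicMeasure T (Φ x) ∧ IsGenericFor T x (Φ x)) →
      ∀ f : C(X, ℝ),
        TendstoUniformly (fun n x => cesaro (⇑T) (⇑f) n x)
          (fun x => ∫ y, f y ∂(Φ x).toMeasure) atTop) := by
  refine ⟨⟨aux_forward T, ?_⟩, fun Φ hΦ hg f => aux_backward T Φ hΦ hg f⟩
  rintro ⟨Φ, hΦ, hg⟩ f
  exact ⟨_, aux_backward T Φ hΦ hg f⟩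
end

section
/- In a partitionable topological dynamical system (X,T), the family of all minimal subsets of X coincides with the family of topological supports of ergodic invariant measures, i.e. with the image of ℳ_T^e(X) under supp. -/
open MeasureTheory Filter Topology Metric

section Helpers

variable {X : Type*} [MetricSpace X] [CompactSpace X]
  [MeasurableSpace X] [BorelSpace X]

lemma aux_preimage {T : X ≃ₜ X} {K : Set X} (h : IsInvariantSet T K) : ⇑T ⁻¹' K = K := by
  unfold IsInvariantSet at h
  conv_lhs => rw [← h]
  exact Set.preimage_image_eq _ T.injective

lemma aux_iter {T : X ≃ₜ X} {K : Set X} (h : IsInvariantSet T K) {x : X} (hx : x ∈ K) (n : ℕ) :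
    T^[n] x ∈ K := by
  induction n with
  | zero => exact hx
  | succ n ih =>
    rw [Function.iterate_succ_apply']
    rw [← aux_preimage h] at ih
    exact ih

lemma aux_msupp (μ : ProbabilityMeasure X) : msupp μ = μ.toMeasure.support := by
  rw [Measure.support_eq_forall_isOpen]
  ext x
  simp only [msupp, Set.mem_ofPred_eq]
  exact ⟨fun h U hx hU => h U hU hx, fun h U hU hx => h U hx hU⟩

lemma aux_exists_inv (T : X ≃ₜ X) (K : Set X) (hne : K.Nonempty) (hc : IsClosed K)
    (hi : IsInvariantSet T K) :
    ∃ μ : ProbabilityMeasure X, IsInvariantMeasure T μ ∧ μ.toMeasure K = 1 := by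
  obtain ⟨x, hx⟩ := hne
  let m : ℕ → Measure X := fun n =>
    ((n + 1 : ℕ) : ENNReal)⁻¹ • ∑ i ∈ Finset.range (n + 1), Measure.dirac (T^[i] x)
  have hm : ∀ n, IsProbabilityMeasure (m n) := by
    intro n
    constructor
    simp only [m, Measure.smul_apply, Measure.finsetSum_apply, measure_univ, Finset.sum_const,
      Finset.card_range, smul_eq_mul, nsmul_eq_mul, mul_one]
    exact ENNReal.inv_mul_cancel (by simp) (ENNReal.natCast_ne_top _)
  have hmK : ∀ n, m n Kᶜ = 0 := by
    intro n
    simp only [m, Measure.smul_apply, Measure.finsetSum_apply, smul_eq_mul]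
    rw [Finset.sum_eq_zero, mul_zero]
    intro i _
    rw [Measure.dirac_apply' _ hc.measurableSet.compl]
    simp [aux_iter hi hx i]
  let p : ℕ → ProbabilityMeasure X := fun n => ⟨m n, hm n⟩
  have hint : ∀ (f : X → ℝ), Continuous f → ∀ n,
      ∫ y, f y ∂(p n).toMeasure = ((n : ℝ) + 1)⁻¹ * ∑ i ∈ Finset.range (n + 1), f (T^[i] x) := by
    intro f hf n
    change ∫ y, f y ∂(m n) = _
    simp only [m]
    rw [integral_smul_measure, integral_finsetSum_measure]
    · simp only [integral_dirac]
      rw [ENNReal.toReal_inv, ENNReal.toReal_natCast, smul_eq_mul, Nat.cast_add, Nat.cast_one]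
    · intro i _
      exact integrable_dirac (by simp)
  let U : Ultrafilter ℕ := hyperfilter ℕ
  obtain ⟨μ, -, hμ⟩ := (isCompact_univ (X := ProbabilityMeasure X)).ultrafilter_le_nhds
    (U.map p) (by simp)
  have ht : Tendsto p (U : Filter ℕ) (𝓝 μ) := hμ
  have hU : (U : Filter ℕ) ≤ atTop := Nat.hyperfilter_le_atTop
  refine ⟨μ, ?_, ?_⟩
  · unfold IsInvariantMeasure
    have := Measure.isProbabilityMeasure_map (μ := μ.toMeasure) T.continuous.measurable.aemeasurable
    apply ext_of_forall_integral_eq_of_IsFiniteMeasure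
    intro f
    rw [integral_map T.continuous.measurable.aemeasurable
      f.continuous.aestronglyMeasurable]
    rw [ProbabilityMeasure.tendsto_iff_forall_integral_tendsto] at ht
    have h1 := ht f
    have h2 := ht (f.compContinuous ⟨T, T.continuous⟩)
    have h3 := h2.sub h1
    have h4 : Tendsto (fun n => ∫ y, (f.compContinuous ⟨T, T.continuous⟩) y ∂(p n).toMeasure
        - ∫ y, f y ∂(p n).toMeasure) (U : Filter ℕ) (𝓝 0) := by
      refine Tendsto.mono_left ?_ hU
      have hb : Tendsto (fun n : ℕ => (2 * ‖f‖) * (1 / ((n : ℝ) + 1))) atTop (𝓝 0) := by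
        simpa using (tendsto_one_div_add_atTop_nhds_zero_nat (𝕜 := ℝ)).const_mul (2 * ‖f‖)
      refine squeeze_zero_norm (fun n => ?_) hb
      rw [hint _ f.continuous, hint _ (BoundedContinuousFunction.continuous _), ← mul_sub,
        ← Finset.sum_sub_distrib]
      have : ∀ i, (f.compContinuous ⟨T, T.continuous⟩) (T^[i] x) = f (T^[i+1] x) := by
        intro i
        rw [Function.iterate_succ_apply']
        rfl
      simp only [this]
      rw [Finset.sum_range_sub (fun i => f (T^[i] x)), norm_mul, mul_comm, one_div]
      have e : ‖((n : ℝ) + 1)⁻¹‖ = ((n : ℝ) + 1)⁻¹ := by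
        rw [Real.norm_of_nonneg]; positivity
      rw [e]
      gcongr
      calc _ ≤ ‖f (T^[n+1] x)‖ + ‖f (T^[0] x)‖ := norm_sub_le _ _
        _ ≤ ‖f‖ + ‖f‖ := add_le_add (f.norm_coe_le_norm _) (f.norm_coe_le_norm _)
        _ = _ := by ring
    exact sub_eq_zero.1 (tendsto_nhds_unique h3 h4)
  · have := ProbabilityMeasure.le_liminf_measure_open_of_tendsto ht hc.isOpen_compl
    have h0 : ∀ n, (p n : Measure X) Kᶜ = 0 := hmK
    simp only [h0, liminf_const, nonpos_iff_eq_zero] at this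
    exact (prob_compl_eq_zero_iff hc.measurableSet).1 this

lemma aux_supp_inv (T : X ≃ₜ X) (μ : ProbabilityMeasure X) (h : IsInvariantMeasure T μ) :
    IsInvariantSet T (msupp μ) := by
  have hpre : ∀ U : Set X, IsOpen U → μ.toMeasure (T ⁻¹' U) = μ.toMeasure U := by
    intro U hU
    conv_rhs => rw [← h, Measure.map_apply T.continuous.measurable hU.measurableSet]
  unfold IsInvariantSet
  apply Set.Subset.antisymm
  · rintro _ ⟨x, hx, rfl⟩ U hU hxU
    rw [← hpre U hU]
    exact hx _ (hU.preimage T.continuous) hxU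
  · intro y hy
    refine ⟨T.symm y, ?_, by simp⟩
    intro U hU hyU
    have h1 : T ⁻¹' (T.symm ⁻¹' U) = U := by ext; simp
    have h2 := hpre (T.symm ⁻¹' U) (hU.preimage T.symm.continuous)
    rw [h1] at h2
    rw [h2]
    exact hy _ (hU.preimage T.symm.continuous) hyU

lemma aux_ergodic_s15 (T : X ≃ₜ X) (A : Set X) (hc : IsClosed A) (hu : UniquelyErgodicOn T A)
    (μ : ProbabilityMeasure X) (h : IsInvariantMeasure T μ) (hA : μ.toMeasure A = 1) :
    IsErgodicMeasure T μ := by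
  have hT : Measurable ⇑T := T.continuous.measurable
  refine ⟨⟨hT, h⟩, ⟨fun s hs hTs => ?_⟩⟩
  by_cases h0 : μ.toMeasure s = 0
  · rw [eventuallyConst_set']
    left
    exact ae_eq_empty.2 h0
  have hP := ProbabilityTheory.cond_isProbabilityMeasure (μ := μ.toMeasure) h0
  let ν : ProbabilityMeasure X := ⟨ProbabilityTheory.cond μ.toMeasure s, hP⟩
  have hν : ν = μ := by
    refine hu.unique ⟨?_, ?_⟩ ⟨h, hA⟩
    · change (ProbabilityTheory.cond μ.toMeasure s).map T = ProbabilityTheory.cond μ.toMeasure s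
      ext t ht
      rw [Measure.map_apply hT ht, ProbabilityTheory.cond_apply hs, ProbabilityTheory.cond_apply hs]
      congr 1
      conv_lhs => rw [← hTs, ← Set.preimage_inter]
      rw [← Measure.map_apply hT (hs.inter ht)]
      exact congrArg (fun m : Measure X => m (s ∩ t)) h
    · change (ProbabilityTheory.cond μ.toMeasure s) A = 1
      rw [← prob_compl_eq_zero_iff hc.measurableSet]
      rw [← prob_compl_eq_zero_iff hc.measurableSet] at hA
      exact ProbabilityTheory.cond_absolutelyContinuous hA
  rw [eventuallyConst_set']
  right
  rw [ae_eq_univ, prob_compl_eq_zero_iff hs]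
  have : ν.toMeasure s = 1 := by
    change (ProbabilityTheory.cond μ.toMeasure s) s = 1
    exact ProbabilityTheory.cond_apply_self h0 (measure_ne_top _ _)
  rwa [hν] at this

lemma aux_trans (T : X ≃ₜ X) (μ : ProbabilityMeasure X) (h : IsErgodicMeasure T μ) :
    ∃ x, ∀ U : Set X, IsOpen U → 0 < μ.toMeasure U → ∃ n : ℕ, T^[n] x ∈ U := by
  have h : Ergodic (⇑T) μ.toMeasure := h
  let B := TopologicalSpace.countableBasis X
  have hB := TopologicalSpace.isBasis_countableBasis X
  have key : ∀ V ∈ B, 0 < μ.toMeasure V → ∀ᵐ x ∂μ.toMeasure, ∃ n : ℕ, T^[n] x ∈ V := by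
    intro V hV hpos
    let W : Set X := {x | ∃ n : ℕ, T^[n] x ∈ V}
    have hW : IsOpen W := by
      have : W = ⋃ n : ℕ, (T^[n]) ⁻¹' V := by ext; simp [W]
      rw [this]
      exact isOpen_iUnion fun n => (hB.isOpen hV).preimage (T.continuous.iterate n)
    have hsub : T ⁻¹' W ⊆ W := by
      rintro x ⟨n, hn⟩
      exact ⟨n + 1, by rwa [Function.iterate_succ_apply]⟩
    rcases h.ae_empty_or_univ_of_preimage_ae_le hW.measurableSet.nullMeasurableSet
      hsub.eventuallyLE with h1 | h1
    · exfalso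
      have : μ.toMeasure V ≤ μ.toMeasure W := measure_mono fun x hx => ⟨0, hx⟩
      rw [ae_eq_empty.1 h1] at this
      exact absurd this (not_le.2 hpos)
    · exact eventuallyEq_univ.1 h1
  have hall : ∀ᵐ x ∂μ.toMeasure, ∀ V ∈ B, 0 < μ.toMeasure V → ∃ n : ℕ, T^[n] x ∈ V := by
    rw [ae_ball_iff (TopologicalSpace.countable_countableBasis X)]
    intro V hV
    by_cases hpos : 0 < μ.toMeasure V
    · filter_upwards [key V hV hpos] with x hx _ using hx
    · exact Eventually.of_forall fun x hx => absurd hx hpos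
  obtain ⟨x, hx⟩ := hall.exists
  refine ⟨x, fun U hU hpos => ?_⟩
  obtain ⟨y, hyU, hy⟩ := Measure.nonempty_inter_support_of_pos hpos
  obtain ⟨V, hV, hyV, hVU⟩ := hB.exists_subset_of_mem_open hyU hU
  obtain ⟨n, hn⟩ := hx V hV
    ((Measure.mem_support_iff_forall y).1 hy V ((hB.isOpen hV).mem_nhds hyV))
  exact ⟨n, hVU hn⟩

lemma aux_supp_sub (μ : ProbabilityMeasure X) (K : Set X) (hK : IsClosed K)
    (h : μ.toMeasure K = 1) : msupp μ ⊆ K := by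
  rw [aux_msupp]
  refine Measure.support_subset_of_isClosed hK ?_
  rw [mem_ae_iff]
  exact (prob_compl_eq_zero_iff hK.measurableSet).2 h

lemma aux_supp_closed (μ : ProbabilityMeasure X) : IsClosed (msupp μ) := by
  rw [aux_msupp]
  exact Measure.isClosed_support

lemma aux_supp_nonempty (μ : ProbabilityMeasure X) : (msupp μ).Nonempty := by
  rw [aux_msupp]
  exact Measure.nonempty_support (IsProbabilityMeasure.ne_zero _)

end Helpers

/-- in a partitionable system the family of minimal sets coincides with the
family of topological supports of ergodic invariant measures. -/
theorem stmt_15 {X : Type*} [MetricSpace X] [CompactSpace X]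
    [MeasurableSpace X] [BorelSpace X] (T : X ≃ₜ X)
    (hp : Partitionable T) :
    {K : Set X | IsMinimalSet T K} = msupp '' ErgodicSet T := by
  obtain ⟨P, ⟨-, hP⟩, hPK⟩ := hp
  ext K
  constructor
  · rintro ⟨⟨x, hx⟩, hKc, hKi, hmin⟩
    obtain ⟨A, ⟨hAP, hxA⟩, -⟩ := hP x
    obtain ⟨hAc, hAi, hAu⟩ := hPK A hAP
    have hKA : K ∩ A = K := by
      refine hmin _ Set.inter_subset_left ⟨x, hx, hxA⟩ (hKc.inter hAc) ?_
      unfold IsInvariantSet at *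
      rw [Set.image_inter T.injective, hKi, hAi]
    obtain ⟨μ, hμi, hμK⟩ := aux_exists_inv T K ⟨x, hx⟩ hKc hKi
    have hμA : μ.toMeasure A = 1 := by
      apply le_antisymm prob_le_one
      rw [← hμK]
      exact measure_mono (Set.inter_eq_left.1 hKA)
    refine ⟨μ, aux_ergodic_s15 T A hAc hAu μ hμi hμA, ?_⟩
    exact hmin _ (aux_supp_sub μ K hKc hμK) (aux_supp_nonempty μ) (aux_supp_closed μ)
      (aux_supp_inv T μ hμi)
  · rintro ⟨μ, hμ, rfl⟩
    have hμ : IsErgodicMeasure T μ := hμ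
    have hμi : IsInvariantMeasure T μ := hμ.toMeasurePreserving.map_eq
    obtain ⟨x, hx⟩ := aux_trans T μ hμ
    obtain ⟨A, ⟨hAP, hxA⟩, -⟩ := hP x
    obtain ⟨hAc, hAi, hAu⟩ := hPK A hAP
    have hsA : msupp μ ⊆ A := by
      intro y hy
      by_contra hyA
      obtain ⟨n, hn⟩ := hx Aᶜ hAc.isOpen_compl (hy _ hAc.isOpen_compl hyA)
      exact hn (aux_iter hAi hxA n)
    have hμs : μ.toMeasure (msupp μ) = 1 := by
      rw [← prob_compl_eq_zero_iff (aux_supp_closed μ).measurableSet, aux_msupp]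
      exact Measure.measure_compl_support
    refine ⟨aux_supp_nonempty μ, aux_supp_closed μ, aux_supp_inv T μ hμi, ?_⟩
    intro K' hK' hne hc hi
    refine Set.Subset.antisymm hK' ?_
    obtain ⟨ν, hνi, hνK⟩ := aux_exists_inv T K' hne hc hi
    have hνμ : ν = μ := by
      refine hAu.unique ⟨hνi, ?_⟩ ⟨hμi, ?_⟩
      · apply le_antisymm prob_le_one
        rw [← hνK]
        exact measure_mono (hK'.trans hsA)
      · apply le_antisymm prob_le_one
        rw [← hμs]
        exact measure_mono hsA
    rw [hνμ] at hνK
    exact aux_supp_sub μ K' hc hνK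
end
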